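/- Let L be a hermitian O_H-lattice of rank m with (x,y) ∈ πO_H for all x,y ∈ L, and let Λ ∈ Vert(L). Set t = t(Λ) and r = dim_{𝔽_p}((π^{-1}Λ♯ ∩ L♯)/Λ) (this quotient is killed by π, hence is naturally a finite-dimensional 𝔽_p-vector space). Then 2r + t ≥ m. -/

import Mathlib

/- Common setup: ramified quadratic extension H/ℚ_p, ring of integers O_H,
   hermitian forms, lattices, duals, vertex lattices. -/

open scoped Classical

noncomputable section

namespace Ramified

/-- The ring of integers of `H`: the integral closure of `ℤ_p` in `H`. -/
def OH (p : ℕ) [Fact (Nat.Prime p)] (H : Type) [Field H] [Algebra ℚ_[p] H] : Subring H :=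
  letI : Algebra ℤ_[p] H := ((algebraMap ℚ_[p] H).comp PadicInt.Coe.ringHom).toAlgebra
  (integralClosure ℤ_[p] H).toSubring

/-- `H/ℚ_p` is a ramified quadratic extension with nontrivial Galois automorphism `conj`
and uniformizer `ϖ` satisfying `conj ϖ = -ϖ` and `ϖ² = π₀` a uniformizer of `ℤ_p`. -/
structure IsRamifiedQuadratic (p : ℕ) [Fact (Nat.Prime p)] (H : Type) [Field H]
    [Algebra ℚ_[p] H] (conj : H ≃+* H) (ϖ : H) : Prop where
  conj_conj : ∀ x : H, conj (conj x) = x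
  conj_fix : ∀ q : ℚ_[p], conj (algebraMap ℚ_[p] H q) = algebraMap ℚ_[p] H q
  conj_ne : conj ≠ RingEquiv.refl H
  dim_two : Module.finrank ℚ_[p] H = 2
  conj_unif : conj ϖ = -ϖ
  unif_sq : ∃ u : ℤ_[p]ˣ, ϖ * ϖ = algebraMap ℚ_[p] H ((u : ℤ_[p]) : ℚ_[p]) * (p : H)

variable {p : ℕ} [Fact (Nat.Prime p)] {H : Type} [Field H] [Algebra ℚ_[p] H]

/-- Any `H`-module is an `O_H`-module by restriction of scalars. -/
instance moduleOH (C : Type) [AddCommGroup C] [Module H C] : Module (OH p H) C :=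
  Module.compHom C (OH p H).subtype

variable {C : Type} [AddCommGroup C] [Module H C]

theorem oh_smul_def (c : OH p H) (x : C) : c • x = (c : H) • x := rfl

/-- A hermitian form on `C` with respect to the conjugation `conj` of `H`:
linear in the first variable, conjugate-symmetric. -/
structure HermForm (H : Type) [Field H] (C : Type) [AddCommGroup C] [Module H C]
    (conj : H ≃+* H) where
  form : C → C → H
  form_add : ∀ x y z : C, form (x + y) z = form x z + form y z
  form_smul : ∀ (a : H) (x y : C), form (a • x) y = a * form x y
  form_conj : ∀ x y : C, form y x = conj (form x y)

variable {conj : H ≃+* H}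

theorem HermForm.form_zero (φ : HermForm H C conj) (y : C) : φ.form 0 y = 0 := by
  have h := φ.form_smul (0 : H) 0 y
  simpa using h

/-- The dual lattice `Λ♯ = {x : C | φ(x, Λ) ⊆ O_H}`. -/
def HermForm.dual (φ : HermForm H C conj) (Λ : Submodule (OH p H) C) :
    Submodule (OH p H) C where
  carrier := {x : C | ∀ y ∈ Λ, φ.form x y ∈ OH p H}
  add_mem' := by
    intro a b ha hb y hy
    rw [φ.form_add]
    exact add_mem (ha y hy) (hb y hy)
  zero_mem' := by
    intro y hy
    rw [HermForm.form_zero]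
    exact zero_mem _
  smul_mem' := by
    intro c x hx y hy
    show φ.form ((c : H) • x) y ∈ OH p H
    rw [φ.form_smul]
    exact mul_mem c.2 (hx y hy)

/-- The orthogonal complement (in `C = L ⊗ H`) of a sublattice. -/
def HermForm.orthog (φ : HermForm H C conj) (N : Submodule (OH p H) C) :
    Submodule (OH p H) C where
  carrier := {x : C | ∀ y ∈ N, φ.form x y = 0}
  add_mem' := by
    intro a b ha hb y hy
    rw [φ.form_add, ha y hy, hb y hy, add_zero]
  zero_mem' := by
    intro y hy
    rw [HermForm.form_zero]
  smul_mem' := by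
    intro c x hx y hy
    show φ.form ((c : H) • x) y = 0
    rw [φ.form_smul, hx y hy, mul_zero]

/-- Scalar multiplication by `a : H`, as an `O_H`-linear map. -/
def smulMap (a : H) : C →ₗ[OH p H] C where
  toFun x := a • x
  map_add' x y := smul_add a x y
  map_smul' c x := by
    show a • ((c : H) • x) = (c : H) • (a • x)
    rw [smul_comm]

/-- The lattice `a • Λ` for a scalar `a : H`. -/
def scale (a : H) (Λ : Submodule (OH p H) C) : Submodule (OH p H) C :=
  Λ.map (smulMap a)

/-- An `H`-subspace of `C`, viewed as an `O_H`-submodule. -/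
def restrictOH (W : Submodule H C) : Submodule (OH p H) C where
  carrier := (W : Set C)
  add_mem' := fun ha hb => W.add_mem ha hb
  zero_mem' := W.zero_mem
  smul_mem' := fun c x hx => W.smul_mem (c : H) hx

/-- The cardinality of the quotient `Λ/N` (for `N ⊆ Λ` this is the usual quotient). -/
def quotCard (N Λ : Submodule (OH p H) C) : ℕ :=
  Nat.card (Λ ⧸ N.comap Λ.subtype)

/-- A (full) `O_H`-lattice in `C`: finitely generated and spanning `C` over `H`. -/
def IsLattice (Λ : Submodule (OH p H) C) : Prop :=
  Λ.FG ∧ Submodule.span H (Λ : Set C) = ⊤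

/-- A vertex lattice: a full lattice with `ϖΛ ⊆ Λ♯ ⊆ Λ`. -/
def IsVertexLattice (φ : HermForm H C conj) (ϖ : H) (Λ : Submodule (OH p H) C) : Prop :=
  IsLattice Λ ∧ scale ϖ Λ ≤ φ.dual Λ ∧ φ.dual Λ ≤ Λ

/-- `Λ ∈ Vert(L)`: a vertex lattice with `L ⊆ Λ♯`. -/
def InVert (φ : HermForm H C conj) (ϖ : H) (L Λ : Submodule (OH p H) C) : Prop :=
  IsVertexLattice φ ϖ Λ ∧ L ≤ φ.dual Λ

/-- `M` is `a`-modular (e.g. `a = ϖ^i`): `(x, M) = a·O_H` for every maximal `x ∈ M`. -/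
def IsPiModular (φ : HermForm H C conj) (ϖ a : H) (M : Submodule (OH p H) C) : Prop :=
  ∀ x ∈ M, x ∉ scale ϖ M →
    (fun y => φ.form x y) '' (M : Set C) = (fun c => a * c) '' ((OH p H : Set H))

/-- `N` is split: an orthogonal direct sum of hyperbolic planes `H(i)`. -/
def IsSplitLat (φ : HermForm H C conj) (ϖ : H) (N : Submodule (OH p H) C) : Prop :=
  ∃ (s : ℕ) (e f : Fin s → C) (d : Fin s → ℕ),
    N = Submodule.span (OH p H) (Set.range e ∪ Set.range f) ∧
    (∀ j, φ.form (e j) (e j) = 0 ∧ φ.form (f j) (f j) = 0 ∧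
      φ.form (e j) (f j) = ϖ ^ d j) ∧
    ∀ j j', j ≠ j' → φ.form (e j) (e j') = 0 ∧ φ.form (e j) (f j') = 0 ∧
      φ.form (f j) (e j') = 0 ∧ φ.form (f j) (f j') = 0

/-- The `O_H`-rank of a sublattice of `C` (the dimension of the subspace it spans). -/
def rk (N : Submodule (OH p H) C) : ℕ :=
  Module.finrank H (Submodule.span H (N : Set C))

/-- A Jordan splitting `L = ⊕_{0 ≤ λ ≤ k} L_λ` with `L_λ` being `ϖ^λ`-modular (or zero). -/
structure JordanSplitting (φ : HermForm H C conj) (ϖ : H) (L : Submodule (OH p H) C)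
    (k : ℕ) (Lc : ℕ → Submodule (OH p H) C) : Prop where
  sup_eq : L = ⨆ i ∈ Finset.range (k + 1), Lc i
  bot_of_gt : ∀ i, k < i → Lc i = ⊥
  disj : ∀ i ∈ Finset.range (k + 1),
    Disjoint (Lc i) (⨆ j ∈ (Finset.range (k + 1)).erase i, Lc j)
  orthog : ∀ i j, i ≠ j → ∀ x ∈ Lc i, ∀ y ∈ Lc j, φ.form x y = 0
  modular : ∀ i ∈ Finset.range (k + 1), Lc i ≠ ⊥ → IsPiModular φ ϖ (ϖ ^ i) (Lc i)

/-- `L_{≥ t} = ⊕_{λ ≥ t} L_λ`. -/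
def Lge (Lc : ℕ → Submodule (OH p H) C) (k t : ℕ) : Submodule (OH p H) C :=
  ⨆ i ∈ Finset.Icc t k, Lc i

/-- `m(L) = rank_{O_H} L_{≥1}`. -/
def mOf (Lc : ℕ → Submodule (OH p H) C) (k : ℕ) : ℕ :=
  ∑ i ∈ Finset.Icc 1 k, rk (Lc i)

/-- The invariant `t(L)` from Theorem A. -/
def tOf (φ : HermForm H C conj) (ϖ : H) (Lc : ℕ → Submodule (OH p H) C) (k : ℕ) : ℕ :=
  if Odd (mOf Lc k) then mOf Lc k - 1
  else if IsSplitLat φ ϖ (Lge Lc k 1) then mOf Lc k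
  else mOf Lc k - 2

/-- `n_odd = Σ_{λ ≥ 3, λ odd} rank L_λ`. -/
def nOdd (Lc : ℕ → Submodule (OH p H) C) (k : ℕ) : ℕ :=
  ∑ i ∈ (Finset.Icc 3 k).filter (fun i => Odd i), rk (Lc i)

/-- `n_even = Σ_{λ ≥ 2, λ even} rank L_λ`. -/
def nEven (Lc : ℕ → Submodule (OH p H) C) (k : ℕ) : ℕ :=
  ∑ i ∈ (Finset.Icc 2 k).filter (fun i => Even i), rk (Lc i)

end Ramified

section Bilinear

variable {p : ℕ} [Fact p.Prime]

/-- A finite abelian group has at most as many `𝔽_p`-valued additive maps as elements. -/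
theorem finite_addMonoidHom_zmod (Q : Type*) [AddCommGroup Q] [Finite Q] :
    Finite (Q →+ ZMod p) ∧ Nat.card (Q →+ ZMod p) ≤ Nat.card Q := by
  cases nonempty_fintype Q
  have hinj : Function.Injective
      (fun f : Q →+ ZMod p => (ZMod.stdAddChar (N := p)).compAddMonoidHom f) := by
    intro f g h
    ext x
    apply ZMod.injective_stdAddChar
    exact DFunLike.congr_fun h x
  have hcard : Nat.card (AddChar Q ℂ) = Nat.card Q := by
    rw [Nat.card_eq_fintype_card, Nat.card_eq_fintype_card, AddChar.card_eq]
  exact ⟨Finite.of_injective _ hinj, hcard ▸ Nat.card_le_card_of_injective _ hinj⟩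

/-- If `U` is the left orthogonal of a subgroup `M ≤ U` for an `𝔽_p`-valued biadditive form on `N`
with `P ≤ U` in its right kernel, then `[N : U] ≤ [U : P]`. -/
theorem index_le_relIndex_of_isotropic {N : Type*} [AddCommGroup N] (β : N →+ N →+ ZMod p)
    (P M U : AddSubgroup N) (hP : ∀ x, ∀ y ∈ P, β x y = 0)
    (hU : ∀ x, x ∈ U ↔ ∀ y ∈ M, β x y = 0) (hMU : M ≤ U) (hfin : P.relIndex U ≠ 0) :
    U.index ≠ 0 ∧ U.index ≤ P.relIndex U := by
  have hle : P.relIndex M ≤ P.relIndex U := AddSubgroup.relIndex_le_of_le_right hMU hfin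
  have hne : P.relIndex M ≠ 0 := fun h => hfin (AddSubgroup.relIndex_eq_zero_of_le_right hMU h)
  have hidxM : (P.addSubgroupOf M).FiniteIndex := ⟨hne⟩
  obtain ⟨_, hcard⟩ := finite_addMonoidHom_zmod (p := p) (M ⧸ P.addSubgroupOf M)
  let γ : N →+ (M ⧸ P.addSubgroupOf M →+ ZMod p) := AddMonoidHom.mk'
    (fun x => QuotientAddGroup.lift (P.addSubgroupOf M) ((β x).comp M.subtype)
      (fun y hy => hP x y hy))
    (by
      intro a b
      ext y
      exact DFunLike.congr_fun (map_add β a b) (y : N))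
  have hker : γ.ker = U := by
    ext x
    rw [AddMonoidHom.mem_ker, hU]
    constructor
    · intro h y hy
      exact DFunLike.congr_fun h (QuotientAddGroup.mk (⟨y, hy⟩ : M))
    · intro h
      ext y
      exact h y y.2
  have hidx : U.index = Nat.card γ.range := by rw [← hker, AddSubgroup.index_ker]
  refine ⟨hidx ▸ Nat.card_pos.ne', ?_⟩
  calc U.index = Nat.card γ.range := hidx
    _ ≤ Nat.card (M ⧸ P.addSubgroupOf M →+ ZMod p) :=
      Nat.card_le_card_of_injective _ Subtype.val_injective
    _ ≤ Nat.card (M ⧸ P.addSubgroupOf M) := hcard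
    _ ≤ P.relIndex U := hle

/-- An injective endomorphism of a free `ℤ_p`-module of rank `n` whose square is a unit times `p`
has image of index `p ^ (n / 2)`. -/
theorem index_range_sq {M : Type*} [AddCommGroup M] [Module ℤ_[p] M] [Module.Free ℤ_[p] M]
    [Module.Finite ℤ_[p] M] (f : M →+ M) (hf : Function.Injective f) (u : ℤ_[p]ˣ)
    (hff : ∀ x, f (f x) = ((u : ℤ_[p]) * p) • x) :
    f.range.index * f.range.index = p ^ Module.finrank ℤ_[p] M := by
  let b := Module.finBasis ℤ_[p] M
  let g : M →+ (Fin (Module.finrank ℤ_[p] M) → ZMod p) :=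
    ((PadicInt.toZMod (p := p)).toAddMonoidHom.compLeft _).comp b.equivFun.toLinearMap.toAddMonoidHom
  have hg : ∀ x i, g x i = PadicInt.toZMod (b.repr x i) := fun x i => rfl
  have hsurj : Function.Surjective g := by
    intro v
    choose w hw using fun i => ZMod.ringHom_surjective (PadicInt.toZMod (p := p)) (v i)
    refine ⟨b.equivFun.symm w, ?_⟩
    ext i
    rw [hg]
    have : b.repr (b.equivFun.symm w) i = w i := by
      rw [← b.equivFun_apply, LinearEquiv.apply_symm_apply]
    rw [this, hw]
  have hker : g.ker = f.range.map f := by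
    ext x
    rw [AddMonoidHom.mem_ker]
    constructor
    · intro h
      have h1 : ∀ i, ∃ c, b.repr x i = p * c := by
        intro i
        have h2 : PadicInt.toZMod (b.repr x i) = 0 := by rw [← hg, h]; rfl
        rw [← RingHom.mem_ker, PadicInt.ker_toZMod, PadicInt.maximalIdeal_eq_span_p,
          Ideal.mem_span_singleton] at h2
        exact h2
      choose c hc using h1
      refine ⟨f (b.equivFun.symm fun i => ↑u⁻¹ * c i), ⟨_, rfl⟩, ?_⟩
      rw [hff]
      apply b.equivFun.injective
      rw [map_smul, LinearEquiv.apply_symm_apply]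
      ext i
      simp only [Pi.smul_apply, smul_eq_mul, b.equivFun_apply, hc]
      calc (u : ℤ_[p]) * p * (↑u⁻¹ * c i) = (u * ↑u⁻¹) * (p * c i) := by ring
        _ = p * c i := by rw [Units.mul_inv, one_mul]
    · rintro ⟨_, ⟨y, rfl⟩, rfl⟩
      rw [hff]
      ext i
      rw [hg]
      simp
  rw [← AddSubgroup.index_map_of_injective _ hf, ← hker, AddSubgroup.index_ker,
    AddMonoidHom.range_eq_top.mpr hsurj]
  simp

end Bilinear

namespace Ramified

section RingOfIntegers

variable (p : ℕ) [Fact p.Prime] (H : Type) [Field H] [Algebra ℚ_[p] H]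

/-- A `ℚ_p`-algebra is a `ℤ_p`-algebra. -/
abbrev padicIntAlgebra : Algebra ℤ_[p] H :=
  ((algebraMap ℚ_[p] H).comp PadicInt.Coe.ringHom).toAlgebra

attribute [local instance] padicIntAlgebra

local instance : IsScalarTower ℤ_[p] ℚ_[p] H := IsScalarTower.of_algebraMap_eq fun _ => rfl

local instance : Module.IsTorsionFree ℤ_[p] H :=
  Module.IsTorsionFree.trans_faithfulSMul ℤ_[p] ℚ_[p] H

theorem mem_OH_iff {x : H} : x ∈ OH p H ↔ IsIntegral ℤ_[p] x := Iff.rfl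

variable {p H}
variable {conj : H ≃+* H} {ϖ : H}

theorem IsRamifiedQuadratic.finiteDimensional (h : IsRamifiedQuadratic p H conj ϖ) :
    FiniteDimensional ℚ_[p] H :=
  Module.finite_of_finrank_pos (by rw [h.dim_two]; norm_num)

theorem IsRamifiedQuadratic.exists_sq (h : IsRamifiedQuadratic p H conj ϖ) :
    ∃ u : ℤ_[p]ˣ, ϖ * ϖ = algebraMap ℤ_[p] H (u * p) := by
  obtain ⟨u, hu⟩ := h.unif_sq
  refine ⟨u, hu.trans ?_⟩
  rw [map_mul, map_natCast]
  rfl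

theorem IsRamifiedQuadratic.unif_ne_zero (h : IsRamifiedQuadratic p H conj ϖ) : ϖ ≠ 0 := by
  obtain ⟨u, hu⟩ := h.exists_sq
  rintro rfl
  rw [zero_mul, eq_comm, FaithfulSMul.algebraMap_eq_zero_iff] at hu
  exact mul_ne_zero u.ne_zero (Nat.cast_ne_zero.mpr (Fact.out : p.Prime).ne_zero) hu

theorem IsRamifiedQuadratic.unif_mem (h : IsRamifiedQuadratic p H conj ϖ) : ϖ ∈ OH p H := by
  obtain ⟨u, hu⟩ := h.exists_sq
  rw [mem_OH_iff]
  refine IsIntegral.of_pow (n := 2) (by norm_num) ?_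
  rw [pow_two, hu]
  exact isIntegral_algebraMap

theorem IsRamifiedQuadratic.conj_mem (h : IsRamifiedQuadratic p H conj ϖ) {x : H}
    (hx : x ∈ OH p H) : conj x ∈ OH p H := by
  rw [mem_OH_iff] at hx ⊢
  let c : H →ₐ[ℤ_[p]] H := { (conj : H →+* H) with commutes' := fun a => h.conj_fix a }
  exact hx.map c

/-- The residue map `O_H → O_H / (ϖ) ≅ 𝔽_p`. -/
theorem IsRamifiedQuadratic.exists_residue (h : IsRamifiedQuadratic p H conj ϖ) :
    ∃ ρ : OH p H →+ ZMod p, ∀ x, ρ x = 0 ↔ ∃ a ∈ OH p H, (x : H) = ϖ * a := by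
  have := h.finiteDimensional
  obtain ⟨u, hu⟩ := h.exists_sq
  let O := integralClosure ℤ_[p] H
  have hfin : Module.Finite ℤ_[p] O := IsIntegralClosure.finite ℤ_[p] ℚ_[p] H O
  have hfree : Module.Free ℤ_[p] O := IsIntegralClosure.module_free ℤ_[p] ℚ_[p] H O
  have hrk : Module.finrank ℤ_[p] O = 2 :=
    (IsIntegralClosure.rank ℤ_[p] ℚ_[p] H O).trans h.dim_two
  let f : O →+ O := AddMonoidHom.mulLeft (⟨ϖ, h.unif_mem⟩ : O)
  have hf : Function.Injective f := mul_right_injective₀ fun h0 =>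
    h.unif_ne_zero (congrArg Subtype.val h0)
  have hff : ∀ x, f (f x) = ((u : ℤ_[p]) * p) • x := by
    intro x
    apply Subtype.ext
    change ϖ * (ϖ * (x : H)) = ((u : ℤ_[p]) * p) • (x : H)
    rw [← mul_assoc, hu, Algebra.smul_def]
  have hidx := index_range_sq f hf u hff
  rw [hrk, pow_two] at hidx
  have hcard : Nat.card (O ⧸ f.range) = p := Nat.mul_self_inj.mp hidx
  have hcyc : IsAddCyclic (O ⧸ f.range) := isAddCyclic_of_prime_card hcard
  let e : O ⧸ f.range ≃+ ZMod p := (hcard ▸ zmodAddCyclicAddEquiv hcyc).symm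
  let ρ : O →+ ZMod p := e.toAddMonoidHom.comp (QuotientAddGroup.mk' f.range)
  refine ⟨ρ, fun x => ?_⟩
  have h1 : ρ x = 0 ↔ (x : O) ∈ f.range := by
    change e (QuotientAddGroup.mk' f.range x) = 0 ↔ _
    rw [EmbeddingLike.map_eq_zero_iff]
    exact QuotientAddGroup.eq_zero_iff _
  refine h1.trans ⟨?_, ?_⟩
  · rintro ⟨a, ha⟩
    exact ⟨a, a.2, congrArg Subtype.val ha.symm⟩
  · rintro ⟨a, ha, hxa⟩
    exact ⟨⟨a, ha⟩, Subtype.ext hxa.symm⟩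

variable {C : Type} [AddCommGroup C] [Module H C]

/-- For a submodule `N` of a lattice `Λ` spanning the space, `[N : ϖN] ≥ p ^ dim C`. -/
theorem IsRamifiedQuadratic.pow_finrank_le (h : IsRamifiedQuadratic p H conj ϖ)
    {N Λ : Submodule (OH p H) C} (hΛ : Λ.FG) (hN : N ≤ Λ)
    (hspan : Submodule.span H (N : Set C) = ⊤) :
    p ^ Module.finrank H C ≤ (scale ϖ N).toAddSubgroup.relIndex N.toAddSubgroup := by
  have := h.finiteDimensional
  obtain ⟨u, hu⟩ := h.exists_sq
  let _ : Module ℚ_[p] C := Module.compHom C (algebraMap ℚ_[p] H)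
  let _ : Module ℤ_[p] C := Module.compHom C (algebraMap ℤ_[p] H)
  have _ : IsScalarTower ℚ_[p] H C := ⟨fun a b x => by
    rw [Algebra.smul_def, mul_smul]; rfl⟩
  have _ : IsScalarTower ℤ_[p] H C := ⟨fun a b x => by
    rw [Algebra.smul_def, mul_smul]; rfl⟩
  have _ : IsScalarTower ℤ_[p] ℚ_[p] C := ⟨fun a b x => by
    rw [Algebra.smul_def, mul_smul]; rfl⟩
  let _ : Algebra ℤ_[p] (OH p H) := inferInstanceAs (Algebra ℤ_[p] (integralClosure ℤ_[p] H))
  have _ : IsScalarTower ℤ_[p] (OH p H) C := ⟨fun a b x => by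
    rw [Algebra.smul_def, mul_smul]; rfl⟩
  have hfinO : Module.Finite ℤ_[p] (OH p H) :=
    IsIntegralClosure.finite ℤ_[p] ℚ_[p] H (integralClosure ℤ_[p] H)
  have hfinΛ : (Λ.restrictScalars ℤ_[p]).FG := hΛ.restrictScalars
  have hfinN : (N.restrictScalars ℤ_[p]).FG := by
    have : Module.Finite ℤ_[p] (Λ.restrictScalars ℤ_[p]) := Module.Finite.iff_fg.mpr hfinΛ
    have : IsNoetherian ℤ_[p] (Λ.restrictScalars ℤ_[p]) :=
      isNoetherian_of_isNoetherianRing_of_finite _ _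
    have := isNoetherian_submodule.mp this
    exact this _ hN
  let N' := N.restrictScalars ℤ_[p]
  have _ : Module.Finite ℤ_[p] N' := Module.Finite.iff_fg.mpr hfinN
  have _ : Module.IsTorsionFree ℤ_[p] C := Module.IsTorsionFree.trans_faithfulSMul ℤ_[p] H C
  have _ : Module.Free ℤ_[p] N' := inferInstance
  have hϖN : ∀ x ∈ N, ϖ • x ∈ N := fun x hx => N.smul_mem ⟨ϖ, h.unif_mem⟩ hx
  let f : N' →+ N' :=
    { toFun := fun x => ⟨ϖ • (x : C), hϖN x x.2⟩
      map_zero' := Subtype.ext (smul_zero ϖ)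
      map_add' := fun x y => Subtype.ext (smul_add ϖ (x : C) y) }
  have hf : Function.Injective f := fun x y hxy =>
    Subtype.ext (smul_right_injective C h.unif_ne_zero (congrArg Subtype.val hxy))
  have hff : ∀ x, f (f x) = ((u : ℤ_[p]) * p) • x := by
    intro x
    apply Subtype.ext
    change ϖ • (ϖ • (x : C)) = ((u : ℤ_[p]) * p) • (x : C)
    rw [← mul_smul, hu, algebraMap_smul]
  have hidx := index_range_sq f hf u hff
  have hrange : (scale ϖ N).toAddSubgroup.addSubgroupOf N.toAddSubgroup = f.range := by
    ext x
    constructor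
    · rintro ⟨y, hy, hxy⟩
      exact ⟨⟨y, hy⟩, Subtype.ext hxy⟩
    · rintro ⟨y, rfl⟩
      exact ⟨y, y.2, rfl⟩
  have hrel : (scale ϖ N).toAddSubgroup.relIndex N.toAddSubgroup = f.range.index := by
    rw [← hrange]; rfl
  let b := Module.finBasis ℤ_[p] N'
  let v : Fin (Module.finrank ℤ_[p] N') → C := fun i => b i
  let W := Submodule.span ℚ_[p] (Set.range v)
  have hNW : ∀ x ∈ N, x ∈ W := by
    intro x hx
    have hx' : x = ∑ i, b.repr ⟨x, hx⟩ i • v i := by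
      have := congrArg N'.subtype (b.sum_repr ⟨x, hx⟩)
      rw [map_sum] at this
      exact this.symm
    rw [hx']
    refine Submodule.sum_mem _ fun i _ => ?_
    rw [← algebraMap_smul ℚ_[p]]
    exact W.smul_mem _ (Submodule.subset_span ⟨i, rfl⟩)
  have hHN : ∀ (a : H), ∀ x ∈ N, a • x ∈ W := by
    intro a x hx
    have : Algebra.IsAlgebraic ℤ_[p] H :=
      (IsFractionRing.comap_isAlgebraic_iff (K := ℚ_[p])).mpr inferInstance
    obtain ⟨y, hy0, hy⟩ := IsAlgebraic.exists_integral_multiple (Algebra.IsAlgebraic.isAlgebraic (R := ℤ_[p]) a)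
    have h1 : (y • a) • x ∈ W := hNW _ (N.smul_mem ⟨y • a, hy⟩ hx)
    have hy0' : algebraMap ℤ_[p] ℚ_[p] y ≠ 0 := by
      rwa [Ne, FaithfulSMul.algebraMap_eq_zero_iff]
    rw [smul_assoc, ← algebraMap_smul ℚ_[p]] at h1
    exact (W.smul_mem_iff hy0').mp h1
  have hW : W = ⊤ := by
    rw [eq_top_iff]
    intro x _
    have hx : x ∈ Submodule.span H (N : Set C) := hspan ▸ Submodule.mem_top
    obtain ⟨k, c, s, rfl⟩ := Submodule.mem_span_set'.mp hx
    exact Submodule.sum_mem _ fun i _ => hHN _ _ (s i).2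
  have hn : Module.finrank ℚ_[p] C ≤ Module.finrank ℤ_[p] N' := by
    have := finrank_range_le_card (R := ℚ_[p]) v
    rwa [Set.finrank, show Submodule.span ℚ_[p] (Set.range v) = ⊤ from hW, finrank_top,
      Fintype.card_fin] at this
  rw [← Module.finrank_mul_finrank ℚ_[p] H C, h.dim_two] at hn
  rw [hrel, ← Nat.mul_self_le_mul_self_iff, hidx, ← pow_add, ← two_mul]
  exact Nat.pow_le_pow_right (Fact.out : p.Prime).pos hn

end RingOfIntegers

section Form

variable {p : ℕ} [Fact p.Prime] {H : Type} [Field H] [Algebra ℚ_[p] H]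
variable {C : Type} [AddCommGroup C] [Module H C] {conj : H ≃+* H} {ϖ : H}

theorem HermForm.form_add_right (φ : HermForm H C conj) (x y z : C) :
    φ.form x (y + z) = φ.form x y + φ.form x z := by
  rw [φ.form_conj (y + z), φ.form_add, map_add, ← φ.form_conj, ← φ.form_conj]

theorem HermForm.form_smul_right (φ : HermForm H C conj) (a : H) (x y : C) :
    φ.form x (a • y) = conj a * φ.form x y := by
  rw [φ.form_conj (a • y), φ.form_smul, map_mul, ← φ.form_conj]

theorem quotCard_eq_relIndex (N Λ : Submodule (OH p H) C) :
    quotCard N Λ = N.toAddSubgroup.relIndex Λ.toAddSubgroup := rfl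

theorem mem_scale_iff {a : H} (ha : a ≠ 0) {Λ : Submodule (OH p H) C} {x : C} :
    x ∈ scale a Λ ↔ a⁻¹ • x ∈ Λ := by
  constructor
  · rintro ⟨y, hy, rfl⟩
    change a⁻¹ • a • y ∈ Λ
    rwa [inv_smul_smul₀ ha]
  · intro h
    exact ⟨_, h, smul_inv_smul₀ ha x⟩

theorem relIndex_scale {a : H} (ha : a ≠ 0) (N Λ : Submodule (OH p H) C) :
    (scale a N).toAddSubgroup.relIndex (scale a Λ).toAddSubgroup =
      N.toAddSubgroup.relIndex Λ.toAddSubgroup := by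
  have hmap : ∀ K : Submodule (OH p H) C, (scale a K).toAddSubgroup =
      K.toAddSubgroup.map (DistribSMul.toAddMonoidHom C a) := fun K => by ext; rfl
  rw [hmap, hmap]
  exact AddSubgroup.relIndex_map_map_of_injective _ _ (smul_right_injective C ha)

/-- The reduction modulo `ϖ` of the form on a submodule where it is integral. -/
theorem HermForm.exists_reduction (φ : HermForm H C conj) (ρ : OH p H →+ ZMod p)
    (N : Submodule (OH p H) C) (hN : ∀ x ∈ N, ∀ y ∈ N, φ.form x y ∈ OH p H) :
    ∃ β : N.toAddSubgroup →+ N.toAddSubgroup →+ ZMod p,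
      ∀ x y, β x y = ρ ⟨φ.form x y, hN x x.2 y y.2⟩ := by
  refine ⟨AddMonoidHom.mk' (fun x => AddMonoidHom.mk'
    (fun y => ρ ⟨φ.form x y, hN x x.2 y y.2⟩) fun y z => ?_) fun x y => ?_, fun x y => rfl⟩
  · rw [← map_add]
    exact congrArg ρ (Subtype.ext (φ.form_add_right _ _ _))
  · ext z
    change ρ _ = ρ _ + ρ _
    rw [← map_add]
    exact congrArg ρ (Subtype.ext (φ.form_add _ _ _))

end Form

/-- For `L` of rank `m` with form valued in `ϖ·O_H`, `Λ ∈ Vert(L)`,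
`t = t(Λ)` and `r = dim_{𝔽_p}((ϖ⁻¹Λ♯ ∩ L♯)/Λ)`, one has `2r + t ≥ m`. -/
theorem statement_2 (p : ℕ) [Fact (Nat.Prime p)] (hp : p ≠ 2)
    (H : Type) [Field H] [Algebra ℚ_[p] H] (conj : H ≃+* H) (ϖ : H)
    (hram : IsRamifiedQuadratic p H conj ϖ)
    (C : Type) [AddCommGroup C] [Module H C]
    (φ : HermForm H C conj)
    (hnd : ∀ x : C, (∀ y : C, φ.form x y = 0) → x = 0)
    (L Λ : Submodule (OH p H) C) (m t r : ℕ)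
    (hL : IsLattice L)
    (hrank : Module.finrank H C = m)
    (hLπ : ∀ x ∈ L, ∀ y ∈ L, ∃ a ∈ OH p H, φ.form x y = ϖ * a)
    (hΛ : InVert φ ϖ L Λ)
    (ht : quotCard (φ.dual Λ) Λ = p ^ t)
    (hr : quotCard Λ (scale ϖ⁻¹ (φ.dual Λ) ⊓ φ.dual L) = p ^ r) :
    m ≤ 2 * r + t := by
  subst hrank
  obtain ⟨⟨⟨hfg, hspan⟩, hsc, hdual⟩, hLN⟩ := hΛ
  obtain ⟨ρ, hρ⟩ := hram.exists_residue
  have hϖ := hram.unif_ne_zero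
  have hp1 : 1 < p := (Fact.out : p.Prime).one_lt
  set N := φ.dual Λ with hNdef
  obtain ⟨β, hβ⟩ := φ.exists_reduction ρ N fun x hx y hy => hx y (hdual hy)
  set U := scale ϖ⁻¹ N ⊓ φ.dual L with hUdef
  have hmemU : ∀ x, x ∈ U ↔ ϖ • x ∈ N ∧ ∀ y ∈ L, φ.form x y ∈ OH p H := by
    intro x
    rw [hUdef, Submodule.mem_inf, mem_scale_iff (inv_ne_zero hϖ), inv_inv]
    rfl
  have hΛU : Λ ≤ U := by
    intro x hx
    refine (hmemU x).mpr ⟨hsc ⟨x, hx, rfl⟩, fun y hy => ?_⟩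
    rw [φ.form_conj]
    exact hram.conj_mem (hLN hy x hx)
  have hUN : scale ϖ U ≤ N := by
    rintro _ ⟨x, hx, rfl⟩
    exact ((hmemU x).mp hx).1
  have hspanN : Submodule.span H (N : Set C) = ⊤ := by
    rw [eq_top_iff, ← hspan, Submodule.span_le]
    intro x hx
    have h1 : ϖ • x ∈ Submodule.span H (N : Set C) := Submodule.subset_span (hsc ⟨x, hx, rfl⟩)
    exact ((Submodule.span H (N : Set C)).smul_mem_iff hϖ).mp h1
  have hlow := hram.pow_finrank_le hfg hdual hspanN
  have hr' : (scale ϖ Λ).toAddSubgroup.relIndex (scale ϖ U).toAddSubgroup = p ^ r := by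
    rw [relIndex_scale hϖ, ← quotCard_eq_relIndex, hr]
  have ht' : (scale ϖ N).toAddSubgroup.relIndex (scale ϖ Λ).toAddSubgroup = p ^ t := by
    rw [relIndex_scale hϖ, ← quotCard_eq_relIndex, ht]
  have hr'' : ((scale ϖ Λ).toAddSubgroup.addSubgroupOf N.toAddSubgroup).relIndex
      ((scale ϖ U).toAddSubgroup.addSubgroupOf N.toAddSubgroup) = p ^ r := by
    rw [AddSubgroup.relIndex_addSubgroupOf hUN, hr']
  have hmain := index_le_relIndex_of_isotropic β
    ((scale ϖ Λ).toAddSubgroup.addSubgroupOf N.toAddSubgroup)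
    (L.toAddSubgroup.addSubgroupOf N.toAddSubgroup)
    ((scale ϖ U).toAddSubgroup.addSubgroupOf N.toAddSubgroup) ?_ ?_ ?_
    (by rw [hr'']; positivity)
  · rw [hr''] at hmain
    have h1 := AddSubgroup.relIndex_mul_relIndex (scale ϖ N).toAddSubgroup
      (scale ϖ Λ).toAddSubgroup (scale ϖ U).toAddSubgroup
      (Submodule.map_mono hdual) (Submodule.map_mono hΛU)
    have h2 := AddSubgroup.relIndex_mul_relIndex (scale ϖ N).toAddSubgroup
      (scale ϖ U).toAddSubgroup N.toAddSubgroup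
      (Submodule.map_mono (hdual.trans hΛU)) hUN
    have h3 : (scale ϖ U).toAddSubgroup.relIndex N.toAddSubgroup ≤ p ^ r := hmain.2
    rw [← h2, ← h1, ht', hr'] at hlow
    have h4 : p ^ Module.finrank H C ≤ p ^ (2 * r + t) :=
      calc _ ≤ p ^ t * p ^ r * p ^ r := hlow.trans (Nat.mul_le_mul_left _ h3)
        _ = p ^ (2 * r + t) := by ring
    exact (Nat.pow_le_pow_iff_right hp1).mp h4
  · rintro x y ⟨z, hz, hzy⟩
    rw [hβ, hρ]
    refine ⟨-φ.form x z, neg_mem (x.2 z hz), ?_⟩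
    change φ.form x (y : C) = _
    rw [show (y : C) = ϖ • z from hzy.symm, φ.form_smul_right, hram.conj_unif]
    ring
  · intro x
    constructor
    · rintro ⟨z, hz, hzx⟩ y hy
      rw [hβ, hρ]
      refine ⟨φ.form z y, ((hmemU z).mp hz).2 y hy, ?_⟩
      change φ.form (x : C) y = _
      rw [show (x : C) = ϖ • z from hzx.symm, φ.form_smul]
    · intro hx
      refine (mem_scale_iff hϖ).mpr ((hmemU _).mpr ⟨?_, fun y hy => ?_⟩)
      · rw [smul_inv_smul₀ hϖ]
        exact x.2
      · have h1 := hx ⟨y, hLN hy⟩ hy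
        rw [hβ, hρ] at h1
        obtain ⟨a, ha, hxa⟩ := h1
        rw [φ.form_smul, show φ.form (N.toAddSubgroup.subtype x) y = ϖ * a from hxa, inv_mul_cancel_left₀ hϖ]
        exact ha
  · intro x hx
    refine (mem_scale_iff hϖ).mpr ((hmemU _).mpr ⟨?_, fun y hy => ?_⟩)
    · rw [smul_inv_smul₀ hϖ]
      exact x.2
    · obtain ⟨a, ha, hxa⟩ := hLπ x hx y hy
      rw [φ.form_smul, show φ.form (N.toAddSubgroup.subtype x) y = ϖ * a from hxa, inv_mul_cancel_left₀ hϖ]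
      exact ha

end Ramified
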